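/- Fix a vertex a ≠ 0 in a finite tree I and write a_i := p^i(a) (so a_0 = a, a_{d(a)} = 0). Set K′ := sup_{b∈I, b≠0} π(B_b)/π(b) and K′_μ := inf_{b∈I, b≠0} μ_b. Then for all 0 ≤ j < n ≤ d(a): E[(T^{a_n}_{a_j})²] ≤ E[T^{a_n}_{a_j}]·( 2·( K′²/K′_μ + E[T^0_{a_j}] ) − 1 ). -/

import Mathlib

open MeasureTheory ProbabilityTheory Filter Topology ENNReal

noncomputable section

/-- A discrete-time birth-and-death chain on a countable rooted tree `I`.
The tree is encoded by a root, a parent map and a depth function; the chain is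
encoded by its transition matrix `P` (nonzero only between tree-neighbours and
on the diagonal) and by the laws `law x` of the trajectories started at `x`,
characterised by the cylinder formula.  `invm` is the reversible invariant
probability measure of the chain (positive recurrence). -/
structure TreeChain (I : Type*) [MeasurableSpace I] where
  root : I
  par : I → I
  depth : I → ℕ
  par_root : par root = root
  depth_root : depth root = 0
  depth_eq_zero : ∀ x, depth x = 0 → x = root
  depth_par : ∀ x, x ≠ root → depth x = depth (par x) + 1
  P : I → I → ℝ≥0∞
  P_row : ∀ x, ∑' y, P x y = 1
  P_support : ∀ x y, P x y ≠ 0 → y = x ∨ y = par x ∨ x = par y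
  lam_pos : ∀ x, x ≠ root → P (par x) x ≠ 0
  mu_pos : ∀ x, x ≠ root → P x (par x) ≠ 0
  law : I → Measure (ℕ → I)
  law_prob : ∀ x, IsProbabilityMeasure (law x)
  law_start : ∀ x, law x {ω | ω 0 = x} = 1
  law_cyl : ∀ x (n : ℕ) (γ : ℕ → I), γ 0 = x →
    law x {ω | ∀ i ≤ n, ω i = γ i} = ∏ i ∈ Finset.range n, P (γ i) (γ (i + 1))
  invm : I → ℝ≥0∞
  invm_pos : ∀ x, invm x ≠ 0
  invm_sum : ∑' x, invm x = 1
  invm_rev : ∀ x y, invm x * P x y = invm y * P y x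

/-- The hitting time of `y`, as an extended nonnegative real (`∞` if `y` is never hit). -/
def hitTime {I : Type*} (y : I) (ω : ℕ → I) : ℝ≥0∞ :=
  ⨅ (t : ℕ) (_ : ω t = y), (t : ℝ≥0∞)

namespace TreeChain

variable {I : Type*} [MeasurableSpace I] (c : TreeChain I)

/-- The branch `B_x` stemming from `x`: the set of descendants of `x` (including `x`). -/
def branch (x : I) : Set I := {y | ∃ n, c.par^[n] y = x}

/-- The set `ℓ(x)` of vertices on the path from `x` to the root, the root excluded. -/
def pathToRoot (x : I) : Set I := {y | ∃ i < c.depth x, c.par^[i] x = y}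

/-- The set `σ(x)` of children of `x`. -/
def children (x : I) : Set I := {y | y ≠ c.root ∧ c.par y = x}

/-- `μ_x`, the transition probability from `x` to its parent. -/
def mu (x : I) : ℝ≥0∞ := c.P x (c.par x)

/-- `λ_x`, the transition probability from the parent of `x` to `x`. -/
def lamP (x : I) : ℝ≥0∞ := c.P (c.par x) x

/-- `π(A)`, the invariant mass of a set of vertices. -/
def piSet (A : Set I) : ℝ≥0∞ := ∑' y : A, c.invm (y : I)

/-- `E[T^x_y]`, the expected hitting time of `y` for the chain started at `x`. -/
def ET (x y : I) : ℝ≥0∞ := ∫⁻ ω, hitTime y ω ∂(c.law x)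

/-- `E[(T^x_y)²]`, the second moment of the hitting time of `y` started at `x`. -/
def ET2 (x y : I) : ℝ≥0∞ := ∫⁻ ω, (hitTime y ω) ^ 2 ∂(c.law x)

/-- The normalised hitting time `T^x_y / E[T^x_y]` as a real random variable. -/
def ratio (x y : I) (ω : ℕ → I) : ℝ := (hitTime y ω).toReal / (c.ET x y).toReal

/-- `α(a)`: the child of the root lying on the path from `a` to the root. -/
def alphaVert (a : I) : I := c.par^[c.depth a - 1] a

/-- The drift constant `K_a = sup_{b ∈ B_{α(a)}} μ_b · E[T^b_{p(b)}]`. -/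
def Kdrift (a : I) : ℝ≥0∞ :=
  ⨆ b ∈ c.branch (c.alphaVert a), c.mu b * c.ET b (c.par b)

/-- The global constant `K'_a = sup_{b ∈ I} μ_b · E[T^b_{p(b)}]`. -/
def Kdrift' : ℝ≥0∞ := ⨆ b : I, c.mu b * c.ET b (c.par b)

/-- The quantity `Q_x = π(B_x)⁻¹ · Σ_{b ∈ B_x} π(B_b)²/(μ_b π(b))`. -/
def Qx (x : I) : ℝ≥0∞ :=
  (c.piSet (c.branch x))⁻¹ *
    ∑' b : c.branch x, (c.piSet (c.branch (b : I))) ^ 2 / (c.mu (b : I) * c.invm (b : I))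

/-- `Q_a = sup_{x ∈ ℓ(a)} Q_x`. -/
def Qsup (a : I) : ℝ≥0∞ := ⨆ x ∈ c.pathToRoot a, c.Qx x

/-- `R_a = Σ_{b ∈ ℓ(a)} π(B_b)²/(μ_b π(b))`. -/
def Rsum (a : I) : ℝ≥0∞ :=
  ∑' b : c.pathToRoot a, (c.piSet (c.branch (b : I))) ^ 2 / (c.mu (b : I) * c.invm (b : I))

/-- The set `C_{a,k}`: union over the vertices `a_l`, `k < l ≤ d(a)`, of the path from
`a_k` to the root, of the branches stemming from the children of `a_l` other
than `a_{l-1}`. -/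
def Cset (a : I) (k : ℕ) : Set I :=
  {y | ∃ l, k + 1 ≤ l ∧ l ≤ c.depth a ∧
    ∃ ch, ch ∈ c.children (c.par^[l] a) ∧ ch ≠ c.par^[l - 1] a ∧ y ∈ c.branch ch}

end TreeChain

/-- The strong drift condition `0^ℓ-SD` toward the root, for a family of chains
`c n` with distinguished vertices `a n` (the limit `a → ∞` being `n → ∞`). -/
def StrongDrift {I : ℕ → Type*} [∀ n, MeasurableSpace (I n)]
    (c : ∀ n, TreeChain (I n)) (a : ∀ n, I n) : Prop :=
  (∃ Kmu : ℝ≥0∞, 0 < Kmu ∧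
      ∀ n, ∀ b ∈ (c n).branch ((c n).alphaVert (a n)), Kmu ≤ (c n).mu b) ∧
  Tendsto (fun n => ((c n).Kdrift (a n)) ^ 2 / (c n).ET (a n) (c n).root) atTop (𝓝 0)


/-! ### Pointwise expansions of the hitting time, measurability -/

lemma measurableSet_apply_eq {ι α : Type*} [MeasurableSpace α] [MeasurableSingletonClass α]
    (i : ι) (z : α) : MeasurableSet {ω : ι → α | ω i = z} := by
  have h := (measurable_pi_apply (X := fun _ : ι => α) i) (measurableSet_singleton z)
  exact h

lemma measurableSet_avoid {α : Type*} [MeasurableSpace α] [MeasurableSingletonClass α]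
    (v : α) (t : ℕ) : MeasurableSet {ω : ℕ → α | ∀ i ≤ t, ω i ≠ v} := by
  simp only [Set.ofPred_forall]
  exact MeasurableSet.iInter fun i => MeasurableSet.iInter fun _ =>
    (measurableSet_apply_eq i v).compl

lemma hitTime_eq_top_or {I : Type*} (y : I) (ω : ℕ → I) :
    (hitTime y ω = ⊤ ∧ ∀ i, ω i ≠ y) ∨
      ∃ s : ℕ, hitTime y ω = s ∧ ∀ t, (∀ i ≤ t, ω i ≠ y) ↔ t < s := by
  classical
  by_cases h : ∃ t, ω t = y
  · right
    refine ⟨Nat.find h, le_antisymm ?_ ?_, fun t => ?_⟩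
    · exact iInf₂_le (f := fun (t : ℕ) (_ : ω t = y) => (t : ℝ≥0∞)) _ (Nat.find_spec h)
    · exact le_iInf₂ fun t ht => by exact_mod_cast Nat.find_min' h ht
    · rw [Nat.lt_find_iff]
  · left
    push Not at h
    exact ⟨by simp [hitTime, h], h⟩

open Classical in
lemma hitTime_eq_tsum {I : Type*} (y : I) (ω : ℕ → I) :
    hitTime y ω = ∑' t : ℕ, {ω : ℕ → I | ∀ i ≤ t, ω i ≠ y}.indicator 1 ω := by
  rcases hitTime_eq_top_or y ω with ⟨h, h'⟩ | ⟨s, h, h'⟩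
  · simp [h, h', Set.indicator]
  · rw [h, tsum_eq_sum (s := Finset.range s) (fun t ht => by
      simpa [Set.indicator, h'] using ht),
      Finset.sum_congr rfl (g := fun _ => 1) fun t ht => by
        simpa [Set.indicator, h'] using ht]
    simp

open Classical in
lemma hitTime_sq_eq_tsum {I : Type*} (y : I) (ω : ℕ → I) :
    hitTime y ω ^ 2 =
      ∑' t : ℕ, (2 * t + 1 : ℝ≥0∞) * {ω : ℕ → I | ∀ i ≤ t, ω i ≠ y}.indicator 1 ω := by
  rcases hitTime_eq_top_or y ω with ⟨h, h'⟩ | ⟨s, h, h'⟩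
  · have : (⊤ : ℝ≥0∞) ≤ ∑' t : ℕ, (2 * t + 1 : ℝ≥0∞) := by
      rw [← ENNReal.tsum_const_eq_top_of_ne_zero (α := ℕ) one_ne_zero]
      exact ENNReal.tsum_le_tsum fun t => le_add_self
    simpa [h, h', Set.indicator] using (top_le_iff.1 this).symm
  · rw [h, tsum_eq_sum (s := Finset.range s) (fun t ht => by
      simpa [Set.indicator, h'] using ht),
      Finset.sum_congr rfl (g := fun t : ℕ => ((2 * t + 1 : ℕ) : ℝ≥0∞)) fun t ht => by
        simp [Set.indicator, h', Finset.mem_range.1 ht]]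
    rw [← Nat.cast_sum, ← Nat.cast_pow]
    congr 1
    clear h h'
    induction s with
    | zero => rfl
    | succ s ih => rw [Finset.sum_range_succ, ← ih]; ring

namespace TreeChain

variable {I : Type*} [MeasurableSpace I] (c : TreeChain I)

/-! ### Measurability of singletons -/

lemma exists_P_ne_zero {a : I} (ha : a ≠ c.root) (x : I) : ∃ z, c.P z x ≠ 0 := by
  by_cases hx : x = c.root
  · suffices ∃ b, b ≠ c.root ∧ c.par b = c.root by
      obtain ⟨b, hb, hpb⟩ := this
      exact ⟨b, by rw [hx, ← hpb]; exact c.mu_pos b hb⟩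
    induction hd : c.depth a generalizing a with
    | zero => exact absurd (c.depth_eq_zero a hd) ha
    | succ n ih =>
      by_cases hp : c.par a = c.root
      · exact ⟨a, ha, hp⟩
      · exact ih hp (by have := c.depth_par a ha; omega)
  · exact ⟨_, c.lam_pos x hx⟩

lemma measurableSingletonClass [Finite I] {a : I} (ha : a ≠ c.root) :
    MeasurableSingletonClass I := by
  refine ⟨fun x => ?_⟩
  suffices measurableAtom x = {x} by
    rw [← this]; exact MeasurableSet.measurableAtom_of_countable x
  refine Set.Subset.antisymm (fun y hy => ?_) (by simp)
  by_contra hyx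
  obtain ⟨z, hz⟩ := c.exists_P_ne_zero ha x
  have := c.law_prob z
  have := Fintype.ofFinite I
  classical
  have hmem : ∀ s : Set I, MeasurableSet s → x ∈ s → y ∈ s := fun s hs hxs =>
    mem_of_mem_measurableAtom hy hs hxs
  set S : I → Set (ℕ → I) := fun w => {ω | ω 0 = z ∧ ω 1 = w} with hS
  have hlaw : ∀ w, c.law z (S w) = c.P z w := fun w => by
    have := c.law_cyl z 1 (fun i => if i = 0 then z else w) rfl
    simp only [Finset.prod_range_one, zero_add, one_ne_zero, if_true, if_false] at this
    convert this using 2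
    · ext ω
      simp only [hS, Set.mem_ofPred_eq]
      refine ⟨fun h i hi => ?_, fun h => ⟨by simpa using h 0 (by simp), by simpa using h 1 le_rfl⟩⟩
      interval_cases i <;> simp [h.1, h.2]
  have hsub : S x ⊆ toMeasurable (c.law z) (S y) := by
    intro ω hω
    have hm : Measurable fun w : I => Function.update ω 1 w := measurable_update ω
    have h1 : Function.update ω 1 x = ω := by rw [← hω.2]; simp
    by_contra hn
    exact hmem _ (hm (measurableSet_toMeasurable (c.law z) (S y)).compl) (by simpa [h1] using hn)
      (subset_toMeasurable _ _ (by simp [hS, hω.1]))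
  have hcover : {ω : ℕ → I | ω 0 = z} ⊆
      ⋃ w ∈ Finset.univ.erase x, toMeasurable (c.law z) (S w) := by
    intro ω hω
    simp only [Set.mem_iUnion]
    by_cases hx1 : ω 1 = x
    · exact ⟨y, by simpa using hyx, hsub ⟨hω, hx1⟩⟩
    · exact ⟨ω 1, by simp [hx1], subset_toMeasurable _ _ ⟨hω, rfl⟩⟩
  have hle : (1 : ℝ≥0∞) ≤ ∑ w ∈ Finset.univ.erase x, c.P z w := by
    rw [← c.law_start z]
    refine (measure_mono hcover).trans ((measure_biUnion_finset_le _ _).trans ?_)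
    simp [measure_toMeasurable, hlaw]
  have hrow := c.P_row z
  rw [tsum_fintype, ← Finset.add_sum_erase _ _ (Finset.mem_univ x)] at hrow
  have hfin : ∑ w ∈ Finset.univ.erase x, c.P z w ≠ ⊤ := by
    refine ne_top_of_le_ne_top ENNReal.one_ne_top (hrow ▸ le_add_self)
  have := ENNReal.lt_add_right hfin hz
  rw [add_comm, hrow] at this
  exact absurd hle (not_le.2 this)

/-! ### The tree order -/

lemma mem_branch_self (x : I) : x ∈ c.branch x := ⟨0, rfl⟩

lemma mem_branch_of_par_mem {x b : I} (h : c.par x ∈ c.branch b) : x ∈ c.branch b := by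
  obtain ⟨n, hn⟩ := h
  exact ⟨n + 1, hn⟩

lemma branch_trans {x y z : I} (hxy : x ∈ c.branch y) (hyz : y ∈ c.branch z) :
    x ∈ c.branch z := by
  obtain ⟨n, rfl⟩ := hxy
  obtain ⟨m, rfl⟩ := hyz
  exact ⟨m + n, Function.iterate_add_apply _ _ _ _⟩

lemma depth_par_le (x : I) : c.depth (c.par x) ≤ c.depth x := by
  by_cases hx : x = c.root
  · rw [hx, c.par_root]
  · have := c.depth_par x hx; omega

lemma depth_le_of_mem_branch {x b : I} (h : x ∈ c.branch b) : c.depth b ≤ c.depth x := by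
  obtain ⟨n, rfl⟩ := h
  induction n with
  | zero => exact le_rfl
  | succ n ih => rw [Function.iterate_succ_apply']; exact (c.depth_par_le _).trans ih

lemma par_notMem_branch {b : I} (hb : b ≠ c.root) : c.par b ∉ c.branch b := fun h => by
  have := c.depth_le_of_mem_branch h
  have := c.depth_par b hb
  omega

lemma mem_branch_root (x : I) : x ∈ c.branch c.root := by
  induction hd : c.depth x generalizing x with
  | zero => rw [c.depth_eq_zero x hd]; exact c.mem_branch_self _
  | succ n ih =>
    have hx : x ≠ c.root := by rintro rfl; simp [c.depth_root] at hd
    exact c.mem_branch_of_par_mem (ih _ (by have := c.depth_par x hx; omega))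

lemma eq_of_P_ne_zero_of_branch {b x y : I} (hx : x ∈ c.branch b) (hy : y ∉ c.branch b)
    (hP : c.P x y ≠ 0) : x = b ∧ y = c.par b := by
  rcases c.P_support x y hP with rfl | rfl | rfl
  · exact absurd hx hy
  · obtain ⟨n, hn⟩ := hx
    cases n with
    | zero => simp only [Function.iterate_zero, id] at hn; simp [hn]
    | succ n => exact absurd ⟨n, hn⟩ hy
  · exact absurd (c.mem_branch_of_par_mem hx) hy

/-! ### Real-valued weights and the flux through an edge -/

/-- The transition probabilities as real numbers. -/
def prob (x y : I) : ℝ := (c.P x y).toReal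

/-- The invariant weights as real numbers. -/
def wt (x : I) : ℝ := (c.invm x).toReal

/-- The conductance `π(b) μ_b` of the edge between `b` and its parent. -/
def cond (b : I) : ℝ := c.wt b * c.prob b (c.par b)

lemma P_ne_top (x y : I) : c.P x y ≠ ⊤ :=
  ne_top_of_le_ne_top ENNReal.one_ne_top (c.P_row x ▸ ENNReal.le_tsum y)

lemma invm_ne_top (x : I) : c.invm x ≠ ⊤ :=
  ne_top_of_le_ne_top ENNReal.one_ne_top (c.invm_sum ▸ ENNReal.le_tsum x)

lemma prob_nonneg (x y : I) : 0 ≤ c.prob x y := ENNReal.toReal_nonneg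

lemma wt_pos (x : I) : 0 < c.wt x := ENNReal.toReal_pos (c.invm_pos x) (c.invm_ne_top x)

lemma cond_pos {b : I} (hb : b ≠ c.root) : 0 < c.cond b :=
  mul_pos (c.wt_pos b) (ENNReal.toReal_pos (c.mu_pos b hb) (c.P_ne_top _ _))

lemma wt_mul_prob (x y : I) : c.wt x * c.prob x y = c.wt y * c.prob y x := by
  simp only [wt, prob, ← ENNReal.toReal_mul, c.invm_rev x y]

variable [Fintype I]

lemma sum_prob (x : I) : ∑ y, c.prob x y = 1 := by
  rw [← ENNReal.toReal_one, ← c.P_row x, tsum_fintype,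
    ENNReal.toReal_sum fun y _ => c.P_ne_top x y]
  rfl

open Classical in
/-- The invariant mass of a set of vertices, as a real number. -/
def mass (A : Set I) : ℝ := ∑ x with x ∈ A, c.wt x

lemma toReal_piSet (A : Set I) : (c.piSet A).toReal = c.mass A := by
  classical
  rw [piSet, tsum_fintype, ENNReal.toReal_sum fun y _ => c.invm_ne_top _, mass,
    ← Finset.sum_subtype_of_mem (p := (· ∈ A)) c.wt (by simp)]
  refine (Finset.sum_congr ?_ fun _ _ => rfl)
  ext x; simp

lemma piSet_ne_top (A : Set I) : c.piSet A ≠ ⊤ := by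
  classical
  rw [piSet, tsum_fintype]
  exact (ENNReal.sum_lt_top.2 fun y _ => (c.invm_ne_top _).lt_top).ne

open Classical in
lemma sum_flux_le {A : Set I} {f r : I → ℝ}
    (h : ∀ x ∈ A, f x ≤ r x + ∑ y, c.prob x y * f y) :
    ∑ x with x ∈ A, ∑ y with y ∉ A, c.wt x * c.prob x y * (f x - f y) ≤
      ∑ x with x ∈ A, c.wt x * r x := by
  have h1 : ∑ x with x ∈ A, ∑ y, c.wt x * c.prob x y * (f x - f y) ≤
      ∑ x with x ∈ A, c.wt x * r x := by
    refine Finset.sum_le_sum fun x hx => ?_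
    have hx' := h x (by simpa using hx)
    have e : ∑ y, c.wt x * c.prob x y * (f x - f y) =
        c.wt x * (f x - ∑ y, c.prob x y * f y) := by
      calc ∑ y, c.wt x * c.prob x y * (f x - f y)
          = c.wt x * ((∑ y, c.prob x y) * f x - ∑ y, c.prob x y * f y) := by
            rw [Finset.sum_mul, ← Finset.sum_sub_distrib, Finset.mul_sum]
            exact Finset.sum_congr rfl fun y _ => by ring
        _ = _ := by rw [c.sum_prob x, one_mul]
    rw [e]
    exact mul_le_mul_of_nonneg_left (by linarith) (c.wt_pos x).le
  have h2 : ∑ x with x ∈ A, ∑ y with y ∈ A, c.wt x * c.prob x y * (f x - f y) = 0 := by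
    have e : ∑ x with x ∈ A, ∑ y with y ∈ A, c.wt x * c.prob x y * (f x - f y) =
        -∑ x with x ∈ A, ∑ y with y ∈ A, c.wt x * c.prob x y * (f x - f y) := by
      conv_lhs => rw [Finset.sum_comm]
      simp only [← Finset.sum_neg_distrib]
      refine Finset.sum_congr rfl fun x _ => Finset.sum_congr rfl fun y _ => ?_
      rw [c.wt_mul_prob y x]; ring
    linarith
  have h3 : ∀ x, ∑ y, c.wt x * c.prob x y * (f x - f y) =
      ∑ y with y ∈ A, c.wt x * c.prob x y * (f x - f y) +
      ∑ y with y ∉ A, c.wt x * c.prob x y * (f x - f y) := fun x =>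
    (Finset.sum_filter_add_sum_filter_not _ _ _).symm
  simp only [h3, Finset.sum_add_distrib, h2, zero_add] at h1
  exact h1

open Classical in
lemma sum_flux_branch {b : I} (hb : b ≠ c.root) (f : I → ℝ) :
    ∑ x with x ∈ c.branch b, ∑ y with y ∉ c.branch b, c.wt x * c.prob x y * (f x - f y) =
      c.cond b * (f b - f (c.par b)) := by
  have hz : ∀ x ∈ c.branch b, ∀ y ∉ c.branch b, ¬ (x = b ∧ y = c.par b) →
      c.wt x * c.prob x y * (f x - f y) = 0 := fun x hx y hy hne => by
    have : c.P x y = 0 := by_contra fun h => hne (c.eq_of_P_ne_zero_of_branch hx hy h)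
    simp [prob, this]
  rw [Finset.sum_eq_single_of_mem b (by simp [c.mem_branch_self]),
    Finset.sum_eq_single_of_mem (c.par b) (by simp [c.par_notMem_branch hb])]
  · rfl
  · intro y hy hyb
    exact hz b (c.mem_branch_self b) y (by simpa using hy) (by simp [hyb])
  · intro x hx hxb
    exact Finset.sum_eq_zero fun y hy =>
      hz x (by simpa using hx) y (by simpa using hy) (by simp [hxb])

open Classical in
lemma cond_mul_sub_par_le {b : I} (hb : b ≠ c.root) {f r : I → ℝ}
    (h : ∀ x ∈ c.branch b, f x ≤ r x + ∑ y, c.prob x y * f y) :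
    c.cond b * (f b - f (c.par b)) ≤ ∑ x with x ∈ c.branch b, c.wt x * r x := by
  rw [← c.sum_flux_branch hb]
  exact c.sum_flux_le h

open Classical in
lemma cond_mul_par_sub_le {b : I} (hb : b ≠ c.root) {f r : I → ℝ}
    (h : ∀ x ∉ c.branch b, f x ≤ r x + ∑ y, c.prob x y * f y) :
    c.cond b * (f (c.par b) - f b) ≤ ∑ x with x ∉ c.branch b, c.wt x * r x := by
  have e : c.cond b * (f (c.par b) - f b) = ∑ x with x ∈ (c.branch b)ᶜ,
      ∑ y with y ∉ (c.branch b)ᶜ, c.wt x * c.prob x y * (f x - f y) := by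
    have := c.sum_flux_branch hb f
    rw [Finset.sum_comm] at this
    simp only [Set.mem_compl_iff, not_not]
    rw [← neg_inj, ← Finset.sum_neg_distrib]
    simp only [← Finset.sum_neg_distrib]
    rw [← mul_neg, neg_sub, ← this]
    refine Finset.sum_congr rfl fun x _ => Finset.sum_congr rfl fun y _ => ?_
    rw [c.wt_mul_prob x y]; ring
  rw [e]
  simpa only [Set.mem_compl_iff] using c.sum_flux_le (A := (c.branch b)ᶜ) h

/-! ### Survival probabilities -/

open Classical in
/-- The probability that the chain started at `x` avoids `v` up to time `t`. -/
def survival (v : I) : ℕ → I → ℝ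
  | 0, x => if x = v then 0 else 1
  | t + 1, x => if x = v then 0 else ∑ y, c.prob x y * survival v t y

lemma survival_nonneg (v : I) (t : ℕ) (x : I) : 0 ≤ c.survival v t x := by
  induction t generalizing x with
  | zero => rw [survival]; split_ifs <;> simp
  | succ t ih =>
    rw [survival]; split_ifs
    · exact le_rfl
    · exact Finset.sum_nonneg fun y _ => mul_nonneg (c.prob_nonneg _ _) (ih y)

lemma survival_self (v : I) (t : ℕ) : c.survival v t v = 0 := by
  cases t <;> simp [survival]

lemma survival_succ {v x : I} (hx : x ≠ v) (t : ℕ) :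
    c.survival v (t + 1) x = ∑ y, c.prob x y * c.survival v t y := by
  simp [survival, hx]

lemma survival_zero {v x : I} (hx : x ≠ v) : c.survival v 0 x = 1 := by
  simp [survival, hx]

lemma law_cylinder_avoid [MeasurableSingletonClass I] (v x : I) (t m : ℕ) (γ : ℕ → I)
    (hγ : γ 0 = x) :
    c.law x {ω | (∀ i ≤ m, ω i = γ i) ∧ ∀ i ≤ t, ω (m + i) ≠ v} =
      (∏ i ∈ Finset.range m, c.P (γ i) (γ (i + 1))) * ENNReal.ofReal (c.survival v t (γ m)) := by
  classical
  have hself : ∀ (t m : ℕ) (γ : ℕ → I), γ m = v →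
      c.law x {ω | (∀ i ≤ m, ω i = γ i) ∧ ∀ i ≤ t, ω (m + i) ≠ v} =
        (∏ i ∈ Finset.range m, c.P (γ i) (γ (i + 1))) *
          ENNReal.ofReal (c.survival v t (γ m)) := by
    intro t m γ hv
    have : {ω : ℕ → I | (∀ i ≤ m, ω i = γ i) ∧ ∀ i ≤ t, ω (m + i) ≠ v} = ∅ := by
      ext ω
      simp only [Set.mem_ofPred_eq, Set.mem_empty_iff_false, iff_false, not_and]
      intro h h'
      exact h' 0 (Nat.zero_le _) (by simpa [hv] using h m le_rfl)
    rw [this, hv, survival_self]; simp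
  induction t generalizing m γ with
  | zero =>
    by_cases hv : γ m = v
    · exact hself _ m γ hv
    rw [c.survival_zero hv, ENNReal.ofReal_one, mul_one, ← c.law_cyl x m γ hγ]
    congr 1
    ext ω
    simp only [Set.mem_ofPred_eq, Nat.le_zero, forall_eq, add_zero, and_iff_left_iff_imp]
    intro h; rwa [h m le_rfl]
  | succ t ih =>
    by_cases hv : γ m = v
    · exact hself _ m γ hv
    set δ : I → ℕ → I := fun y => Function.update γ (m + 1) y with hδ
    have hδ' : ∀ y, ∀ i ≤ m, δ y i = γ i := fun y i hi => by
      simp [hδ, Function.update_of_ne (show i ≠ m + 1 by omega)]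
    have hδm : ∀ y, δ y (m + 1) = y := fun y => by simp [hδ]
    have hset : {ω : ℕ → I | (∀ i ≤ m, ω i = γ i) ∧ ∀ i ≤ t + 1, ω (m + i) ≠ v} =
        ⋃ y, {ω | (∀ i ≤ m + 1, ω i = δ y i) ∧ ∀ i ≤ t, ω (m + 1 + i) ≠ v} := by
      ext ω
      simp only [Set.mem_ofPred_eq, Set.mem_iUnion]
      constructor
      · rintro ⟨h1, h2⟩
        refine ⟨ω (m + 1), fun i hi => ?_, fun i hi => ?_⟩
        · rcases hi.lt_or_eq with hi | rfl
          · rw [hδ' _ i (by omega), h1 i (by omega)]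
          · rw [hδm]
        · rw [add_assoc, add_comm 1]; exact h2 (i + 1) (by omega)
      · rintro ⟨y, h1, h2⟩
        refine ⟨fun i hi => by rw [h1 i (by omega), hδ' y i hi], fun i hi => ?_⟩
        cases i with
        | zero => rwa [add_zero, h1 m (by omega), hδ' y m le_rfl]
        | succ i => have := h2 i (by omega); rwa [add_assoc, add_comm 1] at this
    have hmeas : ∀ y, MeasurableSet
        {ω : ℕ → I | (∀ i ≤ m + 1, ω i = δ y i) ∧ ∀ i ≤ t, ω (m + 1 + i) ≠ v} := fun y => by
      simp only [Set.ofPred_and, Set.ofPred_forall]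
      exact (MeasurableSet.iInter fun i => MeasurableSet.iInter fun _ =>
        measurableSet_apply_eq i _).inter (MeasurableSet.iInter fun i =>
          MeasurableSet.iInter fun _ => (measurableSet_apply_eq _ v).compl)
    rw [hset, measure_iUnion _ hmeas, tsum_fintype, c.survival_succ hv,
      ENNReal.ofReal_sum_of_nonneg fun y _ =>
        mul_nonneg (c.prob_nonneg _ _) (c.survival_nonneg _ _ _), Finset.mul_sum]
    · refine Finset.sum_congr rfl fun y _ => ?_
      rw [ih (m + 1) (δ y) ((hδ' y 0 (Nat.zero_le _)).trans hγ), Finset.prod_range_succ, hδm,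
        hδ' y m le_rfl, ENNReal.ofReal_mul (c.prob_nonneg _ _), prob,
        ENNReal.ofReal_toReal (c.P_ne_top _ _), mul_assoc]
      congr 1
      refine Finset.prod_congr rfl fun i hi => ?_
      have := Finset.mem_range.1 hi
      rw [hδ' y i (by omega), hδ' y (i + 1) (by omega)]
    · intro y z hyz
      refine Set.disjoint_left.2 fun ω h1 h2 => hyz ?_
      rw [← hδm y, ← hδm z, ← h1.1 _ le_rfl, h2.1 _ le_rfl]

lemma law_avoid [MeasurableSingletonClass I] (v x : I) (t : ℕ) :
    c.law x {ω | ∀ i ≤ t, ω i ≠ v} = ENNReal.ofReal (c.survival v t x) := by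
  have := c.law_prob x
  have h := c.law_cylinder_avoid v x t 0 (fun _ => x) rfl
  simp only [Nat.le_zero, forall_eq, zero_add, Finset.range_zero, Finset.prod_empty,
    one_mul] at h
  rw [← h]
  have h0 : ∀ᵐ ω ∂c.law x, ω 0 = x := by
    exact (mem_ae_iff_prob_eq_one (measurableSet_apply_eq 0 x)).2 (c.law_start x)
  refine measure_congr ?_
  filter_upwards [h0] with ω hω
  exact propext ⟨fun h => ⟨hω, h⟩, fun h => h.2⟩

/-! ### Moments of hitting times -/

lemma ET_eq_tsum [MeasurableSingletonClass I] (x v : I) :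
    c.ET x v = ∑' t, ENNReal.ofReal (c.survival v t x) := by
  simp only [ET, hitTime_eq_tsum]
  rw [lintegral_tsum fun t =>
    (measurable_one.indicator (measurableSet_avoid v t)).aemeasurable]
  refine tsum_congr fun t => ?_
  rw [lintegral_indicator_one (measurableSet_avoid v t), law_avoid]

lemma ET2_eq_tsum [MeasurableSingletonClass I] (x v : I) :
    c.ET2 x v = ∑' t : ℕ, ENNReal.ofReal ((2 * t + 1) * c.survival v t x) := by
  simp only [ET2, hitTime_sq_eq_tsum]
  rw [lintegral_tsum fun t =>
    ((measurable_one.indicator (measurableSet_avoid v t)).const_mul _).aemeasurable]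
  refine tsum_congr fun t => ?_
  rw [lintegral_const_mul _ (measurable_one.indicator (measurableSet_avoid v t)),
    lintegral_indicator_one (measurableSet_avoid v t), law_avoid,
    ENNReal.ofReal_mul (by positivity)]
  congr 1
  rw [ENNReal.ofReal_add (by positivity) (by positivity), ENNReal.ofReal_mul (by positivity)]
  simp

/-- The truncated mean `E[T ∧ N]`. -/
def truncMean (v : I) (N : ℕ) (x : I) : ℝ := ∑ t ∈ Finset.range N, c.survival v t x

/-- The truncated second moment `E[(T ∧ N)²]`. -/
def truncSq (v : I) (N : ℕ) (x : I) : ℝ :=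
  ∑ t ∈ Finset.range N, (2 * t + 1) * c.survival v t x

/-- The mean hitting time of `v`, as a real number. -/
def mean (v x : I) : ℝ := ∑' t, c.survival v t x

lemma truncMean_self (v : I) (N : ℕ) : c.truncMean v N v = 0 := by
  simp [truncMean, survival_self]

lemma truncSq_self (v : I) (N : ℕ) : c.truncSq v N v = 0 := by
  simp [truncSq, survival_self]

lemma mean_self (v : I) : c.mean v v = 0 := by
  simp [mean, survival_self]

lemma mean_nonneg (v x : I) : 0 ≤ c.mean v x :=
  tsum_nonneg fun t => c.survival_nonneg v t x

lemma truncMean_succ {v x : I} (hx : x ≠ v) (N : ℕ) :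
    c.truncMean v (N + 1) x = 1 + ∑ y, c.prob x y * c.truncMean v N y := by
  simp only [truncMean, Finset.sum_range_succ', c.survival_zero hx, c.survival_succ hx,
    Finset.mul_sum]
  rw [Finset.sum_comm, add_comm]

lemma truncSq_succ {v x : I} (hx : x ≠ v) (N : ℕ) :
    c.truncSq v (N + 1) x =
      2 * c.truncMean v (N + 1) x - 1 + ∑ y, c.prob x y * c.truncSq v N y := by
  rw [c.truncMean_succ hx]
  simp only [truncMean, truncSq, Finset.sum_range_succ', c.survival_zero hx,
    c.survival_succ hx, Finset.mul_sum]
  rw [Finset.sum_comm (s := Finset.univ), Finset.sum_comm (s := Finset.univ)]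
  have : ∀ t ∈ Finset.range N, ∑ y, (2 * ((t + 1 : ℕ) : ℝ) + 1) * (c.prob x y * c.survival v t y)
      = 2 * ∑ y, c.prob x y * c.survival v t y +
        ∑ y, c.prob x y * ((2 * t + 1) * c.survival v t y) := fun t _ => by
    rw [Finset.mul_sum, ← Finset.sum_add_distrib]
    exact Finset.sum_congr rfl fun y _ => by push_cast; ring
  rw [Finset.sum_congr rfl this, Finset.sum_add_distrib, ← Finset.mul_sum]
  push_cast
  ring

lemma truncMean_le_succ (v : I) (N : ℕ) (x : I) :
    c.truncMean v N x ≤ c.truncMean v (N + 1) x := by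
  rw [truncMean, truncMean, Finset.sum_range_succ]
  linarith [c.survival_nonneg v N x]

lemma truncSq_le_succ (v : I) (N : ℕ) (x : I) :
    c.truncSq v N x ≤ c.truncSq v (N + 1) x := by
  rw [truncSq, truncSq, Finset.sum_range_succ]
  have := mul_nonneg (by positivity : (0 : ℝ) ≤ 2 * N + 1) (c.survival_nonneg v N x)
  linarith

lemma exists_truncMean_le (v x : I) : ∃ C, ∀ N, c.truncMean v N x ≤ C := by
  classical
  have hsub : ∀ N, ∀ x ≠ v,
      c.truncMean v N x ≤ 1 + ∑ y, c.prob x y * c.truncMean v N y := fun N x hx =>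
    (c.truncMean_le_succ v N x).trans_eq (c.truncMean_succ hx N)
  have hup : ∀ b, v ∈ c.branch b → (∃ C, ∀ N, c.truncMean v N b ≤ C) →
      ∃ C, ∀ N, c.truncMean v N (c.par b) ≤ C := by
    rintro b hvb ⟨C, hC⟩
    by_cases hb : b = c.root
    · rw [hb, c.par_root, ← hb]; exact ⟨C, hC⟩
    refine ⟨C + (∑ x with x ∉ c.branch b, c.wt x * 1) / c.cond b, fun N => ?_⟩
    have := c.cond_mul_par_sub_le hb (f := c.truncMean v N) (r := fun _ => 1)
      fun x hx => hsub N x fun h => hx (h ▸ hvb)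
    rw [← le_div_iff₀' (c.cond_pos hb)] at this
    linarith [hC N]
  have hanc : ∀ n, ∃ C, ∀ N, c.truncMean v N (c.par^[n] v) ≤ C := fun n => by
    induction n with
    | zero => exact ⟨0, fun N => (c.truncMean_self v N).le⟩
    | succ n ih => rw [Function.iterate_succ_apply']; exact hup _ ⟨n, rfl⟩ ih
  induction hd : c.depth x generalizing x with
  | zero =>
    obtain ⟨n, hn⟩ := c.mem_branch_root v
    rw [c.depth_eq_zero x hd, ← hn]
    exact hanc n
  | succ d ih =>
    have hx : x ≠ c.root := by rintro rfl; simp [c.depth_root] at hd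
    by_cases hvx : v ∈ c.branch x
    · obtain ⟨n, rfl⟩ := hvx
      exact hanc n
    · obtain ⟨C, hC⟩ := ih (c.par x) (by have := c.depth_par x hx; omega)
      refine ⟨C + (∑ y with y ∈ c.branch x, c.wt y * 1) / c.cond x, fun N => ?_⟩
      have := c.cond_mul_sub_par_le hx (f := c.truncMean v N) (r := fun _ => 1)
        fun y hy => hsub N y fun h => hvx (h ▸ hy)
      rw [← le_div_iff₀' (c.cond_pos hx)] at this
      linarith [hC N]

lemma summable_survival (v x : I) : Summable fun t => c.survival v t x := by
  obtain ⟨C, hC⟩ := c.exists_truncMean_le v x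
  exact summable_of_sum_range_le (fun t => c.survival_nonneg v t x) hC

lemma ET_eq_ofReal_mean [MeasurableSingletonClass I] (x v : I) :
    c.ET x v = ENNReal.ofReal (c.mean v x) := by
  rw [ET_eq_tsum, mean, ENNReal.ofReal_tsum_of_nonneg (fun t => c.survival_nonneg v t x)
    (c.summable_survival v x)]

lemma truncMean_le_mean (v : I) (N : ℕ) (x : I) : c.truncMean v N x ≤ c.mean v x :=
  (c.summable_survival v x).sum_le_tsum _ fun t _ => c.survival_nonneg v t x

lemma mean_eq {v x : I} (hx : x ≠ v) :
    c.mean v x = 1 + ∑ y, c.prob x y * c.mean v y := by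
  have hlim : ∀ y, Tendsto (fun N => c.truncMean v N y) atTop (𝓝 (c.mean v y)) := fun y =>
    (c.summable_survival v y).hasSum.tendsto_sum_nat
  refine tendsto_nhds_unique ((hlim x).comp (tendsto_add_atTop_nat 1)) ?_
  simp only [Function.comp_def, c.truncMean_succ hx]
  exact (tendsto_finsetSum _ fun y _ => (hlim y).const_mul _).const_add 1

lemma truncSq_le {v x : I} (hx : x ≠ v) (N : ℕ) :
    c.truncSq v N x ≤ (2 * c.mean v x - 1) + ∑ y, c.prob x y * c.truncSq v N y := by
  refine (c.truncSq_le_succ v N x).trans ?_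
  rw [c.truncSq_succ hx]
  linarith [c.truncMean_le_mean v (N + 1) x]

/-! ### Mean hitting times along the tree -/

lemma cond_mul_mean_sub_le {v b : I} (hb : b ≠ c.root) (hv : v ∉ c.branch b) :
    c.cond b * (c.mean v b - c.mean v (c.par b)) ≤ c.mass (c.branch b) := by
  have := c.cond_mul_sub_par_le hb (f := c.mean v) (r := fun _ => 1) fun x hx =>
    (c.mean_eq (by rintro rfl; exact hv hx)).le
  simpa [mass] using this

lemma cond_mul_mean_par_sub {v b : I} (hb : b ≠ c.root) (hv : v ∈ c.branch b) :
    c.cond b * (c.mean v (c.par b) - c.mean v b) = c.mass (c.branch b)ᶜ := by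
  classical
  have h1 := c.cond_mul_par_sub_le hb (f := c.mean v) (r := fun _ => 1) fun x hx =>
    (c.mean_eq (by rintro rfl; exact hx hv)).le
  have h2 := c.cond_mul_par_sub_le hb (f := fun x => -c.mean v x) (r := fun _ => -1)
    fun x hx => by
      rw [c.mean_eq (show x ≠ v by rintro rfl; exact hx hv)]
      simp only [mul_neg, Finset.sum_neg_distrib]
      linarith
  simp only [mul_neg, mul_one, Finset.sum_neg_distrib] at h1 h2
  have h3 : c.mass (c.branch b)ᶜ = ∑ x with x ∉ c.branch b, c.wt x := by simp [mass]
  rw [h3]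
  linarith

lemma mass_nonneg (A : Set I) : 0 ≤ c.mass A :=
  Finset.sum_nonneg fun x _ => (c.wt_pos x).le

open Classical in
lemma mean_le_root_add_sum (v x : I) :
    c.mean v x ≤ c.mean v c.root +
      ∑ b with x ∈ c.branch b ∧ v ∉ c.branch b, c.mass (c.branch b) / c.cond b := by
  have hnn : ∀ b, v ∉ c.branch b → 0 ≤ c.mass (c.branch b) / c.cond b := fun b hv =>
    div_nonneg (c.mass_nonneg _)
      (c.cond_pos (by rintro rfl; exact hv (c.mem_branch_root v))).le
  induction hd : c.depth x generalizing x with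
  | zero =>
    rw [c.depth_eq_zero x hd, le_add_iff_nonneg_right]
    exact Finset.sum_nonneg fun b hb => hnn b (Finset.mem_filter.1 hb).2.2
  | succ d ih =>
    have hx : x ≠ c.root := by rintro rfl; simp [c.depth_root] at hd
    have ih := ih (c.par x) (by have := c.depth_par x hx; omega)
    have hsub : (Finset.univ.filter fun b => c.par x ∈ c.branch b ∧ v ∉ c.branch b) ⊆
        Finset.univ.filter fun b => x ∈ c.branch b ∧ v ∉ c.branch b := fun b hb => by
      simp only [Finset.mem_filter, Finset.mem_univ, true_and] at hb ⊢
      exact ⟨c.mem_branch_of_par_mem hb.1, hb.2⟩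
    by_cases hvx : v ∈ c.branch x
    · have h1 := c.cond_mul_mean_par_sub hx hvx
      have h2 : 0 ≤ c.mean v (c.par x) - c.mean v x :=
        nonneg_of_mul_nonneg_right (h1 ▸ c.mass_nonneg _) (c.cond_pos hx)
      have h3 := Finset.sum_le_sum_of_subset_of_nonneg hsub
        (f := fun b => c.mass (c.branch b) / c.cond b)
        fun b hb _ => hnn b (Finset.mem_filter.1 hb).2.2
      linarith
    · have h1 := c.cond_mul_mean_sub_le hx hvx
      rw [← le_div_iff₀' (c.cond_pos hx)] at h1
      have h3 := Finset.sum_le_sum_of_subset_of_nonneg (s := insert x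
        (Finset.univ.filter fun b => c.par x ∈ c.branch b ∧ v ∉ c.branch b))
        (t := Finset.univ.filter fun b => x ∈ c.branch b ∧ v ∉ c.branch b)
        (f := fun b => c.mass (c.branch b) / c.cond b)
        (Finset.insert_subset (by simp [c.mem_branch_self, hvx]) hsub)
        fun b hb _ => hnn b (Finset.mem_filter.1 hb).2.2
      rw [Finset.sum_insert (by simp [c.par_notMem_branch hx])] at h3
      linarith

open Classical in
lemma sum_wt_mul_mean_le {v a : I} (hv : v ∈ c.branch a) {κ : ℝ}
    (hκ : ∀ b ≠ c.root, c.mass (c.branch b) / c.cond b * c.mass (c.branch b) ≤ κ * c.wt b) :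
    ∑ x with x ∉ c.branch a, c.wt x * c.mean v x ≤
      (κ + c.mean v c.root) * c.mass (c.branch a)ᶜ := by
  have hroot : ∀ b, v ∉ c.branch b → b ≠ c.root := by
    rintro b hb rfl; exact hb (c.mem_branch_root v)
  have h1 : ∑ x with x ∉ c.branch a,
      c.wt x * ∑ b with x ∈ c.branch b ∧ v ∉ c.branch b, c.mass (c.branch b) / c.cond b ≤
      κ * c.mass (c.branch a)ᶜ := by
    simp only [Finset.mul_sum]
    rw [Finset.sum_comm' (t' := Finset.univ.filter fun b => b ∉ c.branch a ∧ v ∉ c.branch b)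
      (s' := fun b => Finset.univ.filter fun x => x ∈ c.branch b ∧ x ∉ c.branch a)
      (fun x b => by
        simp only [Finset.mem_filter, Finset.mem_univ, true_and]
        exact ⟨fun h => ⟨⟨h.2.1, h.1⟩, fun hb => h.1 (c.branch_trans h.2.1 hb), h.2.2⟩,
          fun h => ⟨h.1.2, h.1.1, h.2.2⟩⟩)]
    have hle : ∀ b ∈ Finset.univ.filter fun b => b ∉ c.branch a ∧ v ∉ c.branch b,
        ∑ x with x ∈ c.branch b ∧ x ∉ c.branch a, c.wt x * (c.mass (c.branch b) / c.cond b) ≤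
          κ * c.wt b := fun b hb => by
      have hbr := hroot b (Finset.mem_filter.1 hb).2.2
      refine le_trans ?_ (hκ b hbr)
      rw [← Finset.sum_mul, mul_comm]
      refine mul_le_mul_of_nonneg_left ?_ (div_nonneg (c.mass_nonneg _) (c.cond_pos hbr).le)
      refine Finset.sum_le_sum_of_subset_of_nonneg (fun x hx => ?_) fun x _ _ => (c.wt_pos x).le
      simp only [Finset.mem_filter, Finset.mem_univ, true_and] at hx ⊢
      exact hx.1
    refine (Finset.sum_le_sum hle).trans ?_
    rw [mass, Finset.mul_sum]
    refine Finset.sum_le_sum_of_subset_of_nonneg (fun x hx => ?_) fun x hx _ => ?_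
    · simp only [Finset.mem_filter, Finset.mem_univ, true_and] at hx
      simpa using hx.1
    · have hxa : x ∉ c.branch a := by simpa using hx
      by_cases hxr : x = c.root
      · have : 0 ≤ κ := by
          by_contra! hneg
          have har : a ≠ c.root := by
            rintro rfl; exact hxa (c.mem_branch_root x)
          have := hκ a har
          have h0 : 0 ≤ c.mass (c.branch a) / c.cond a * c.mass (c.branch a) :=
            mul_nonneg (div_nonneg (c.mass_nonneg _) (c.cond_pos har).le) (c.mass_nonneg _)
          linarith [mul_neg_of_neg_of_pos hneg (c.wt_pos a)]
        exact mul_nonneg this (c.wt_pos x).le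
      · exact le_trans (mul_nonneg (div_nonneg (c.mass_nonneg _) (c.cond_pos hxr).le)
          (c.mass_nonneg _)) (hκ x hxr)
  have h2 : ∑ x with x ∉ c.branch a, c.wt x * c.mean v x ≤
      ∑ x with x ∉ c.branch a, (c.wt x * c.mean v c.root +
        c.wt x * ∑ b with x ∈ c.branch b ∧ v ∉ c.branch b,
          c.mass (c.branch b) / c.cond b) := by
    refine Finset.sum_le_sum fun x _ => ?_
    rw [← mul_add]
    exact mul_le_mul_of_nonneg_left (c.mean_le_root_add_sum v x) (c.wt_pos x).le
  rw [Finset.sum_add_distrib, ← Finset.sum_mul] at h2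
  have h3 : c.mass (c.branch a)ᶜ = ∑ x with x ∉ c.branch a, c.wt x := by
    simp [mass]
  rw [h3] at h1 ⊢
  linarith

lemma truncSq_iterate_par_le (v : I) {κ : ℝ}
    (hκ : ∀ b ≠ c.root, c.mass (c.branch b) / c.cond b * c.mass (c.branch b) ≤ κ * c.wt b)
    (N i : ℕ) :
    c.truncSq v N (c.par^[i] v) ≤
      c.mean v (c.par^[i] v) * (2 * (κ + c.mean v c.root) - 1) := by
  classical
  induction i with
  | zero => simp [truncSq_self, mean_self]
  | succ i ih =>
    rw [Function.iterate_succ_apply']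
    set b := c.par^[i] v with hb
    have hv : v ∈ c.branch b := ⟨i, rfl⟩
    by_cases hbr : b = c.root
    · rw [show c.par b = b by rw [hbr, c.par_root]]
      exact ih
    have h1 := c.cond_mul_par_sub_le hbr (f := c.truncSq v N)
      (r := fun x => 2 * c.mean v x - 1) fun x hx =>
        c.truncSq_le (by rintro rfl; exact hx hv) N
    have h2 := c.sum_wt_mul_mean_le hv hκ
    have h3 : ∑ x with x ∉ c.branch b, c.wt x * (2 * c.mean v x - 1) =
        2 * (∑ x with x ∉ c.branch b, c.wt x * c.mean v x) - c.mass (c.branch b)ᶜ := by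
      simp only [mass, Set.mem_compl_iff, Finset.mul_sum, ← Finset.sum_sub_distrib]
      exact Finset.sum_congr rfl fun x _ => by ring
    have h4 : c.cond b * (c.truncSq v N (c.par b) - c.truncSq v N b) ≤
        c.cond b * ((c.mean v (c.par b) - c.mean v b) *
          (2 * (κ + c.mean v c.root) - 1)) := by
      rw [← mul_assoc, c.cond_mul_mean_par_sub hbr hv]
      linarith
    have h5 := le_of_mul_le_mul_left h4 (c.cond_pos hbr)
    linarith

lemma ET2_iterate_par_le_ofReal [MeasurableSingletonClass I] (v : I) {κ : ℝ}
    (hκ : ∀ b ≠ c.root, c.mass (c.branch b) / c.cond b * c.mass (c.branch b) ≤ κ * c.wt b)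
    (i : ℕ) :
    c.ET2 (c.par^[i] v) v ≤ ENNReal.ofReal
      (c.mean v (c.par^[i] v) * (2 * (κ + c.mean v c.root) - 1)) := by
  rw [ET2_eq_tsum]
  refine ENNReal.tsum_le_of_sum_range_le fun N => ?_
  rw [← ENNReal.ofReal_sum_of_nonneg fun t _ =>
    mul_nonneg (by positivity) (c.survival_nonneg _ _ _)]
  exact ENNReal.ofReal_le_ofReal (c.truncSq_iterate_par_le v hκ N i)

/-! ### The global constants -/

lemma iSup_piSet_div_ne_top :
    (⨆ b ∈ {b : I | b ≠ c.root}, c.piSet (c.branch b) / c.invm b) ≠ ⊤ := by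
  have hfin : ∑ b, c.piSet (c.branch b) / c.invm b < ⊤ :=
    ENNReal.sum_lt_top.2 fun b _ => ENNReal.div_lt_top (c.piSet_ne_top _) (c.invm_pos b)
  refine (lt_of_le_of_lt (iSup₂_le fun b _ => ?_) hfin).ne
  exact Finset.single_le_sum (f := fun b => c.piSet (c.branch b) / c.invm b)
    (fun _ _ => zero_le) (Finset.mem_univ b)

lemma iInf_mu_ne_zero : (⨅ b ∈ {b : I | b ≠ c.root}, c.mu b) ≠ 0 := by
  classical
  rw [← ENNReal.inv_ne_top, ENNReal.inv_iInf]
  simp only [ENNReal.inv_iInf]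
  have hfin : ∑ b with b ≠ c.root, (c.mu b)⁻¹ < ⊤ :=
    ENNReal.sum_lt_top.2 fun b hb =>
      ENNReal.inv_lt_top.2 (pos_iff_ne_zero.2 (c.mu_pos b (Finset.mem_filter.1 hb).2))
  refine (lt_of_le_of_lt (iSup₂_le fun b hb => ?_) hfin).ne
  exact Finset.single_le_sum (f := fun b => (c.mu b)⁻¹) (fun _ _ => zero_le)
    (Finset.mem_filter.2 ⟨Finset.mem_univ b, hb⟩)

lemma mass_div_cond_mul_mass_le {b : I} (hb : b ≠ c.root) :
    c.mass (c.branch b) / c.cond b * c.mass (c.branch b) ≤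
      ((⨆ b ∈ {b : I | b ≠ c.root}, c.piSet (c.branch b) / c.invm b) ^ 2 /
        (⨅ b ∈ {b : I | b ≠ c.root}, c.mu b)).toReal * c.wt b := by
  set K := ⨆ b ∈ {b : I | b ≠ c.root}, c.piSet (c.branch b) / c.invm b
  set M := ⨅ b ∈ {b : I | b ≠ c.root}, c.mu b
  have hM : M ≤ c.mu b := iInf₂_le (f := fun b _ => c.mu b) b hb
  have hK : c.piSet (c.branch b) / c.invm b ≤ K :=
    le_iSup₂ (f := fun b (_ : b ∈ {b : I | b ≠ c.root}) => c.piSet (c.branch b) / c.invm b) b hb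
  have hM0 : 0 < M.toReal := ENNReal.toReal_pos c.iInf_mu_ne_zero
    (ne_top_of_le_ne_top (c.P_ne_top _ _) hM)
  have hM' : M.toReal ≤ c.prob b (c.par b) := ENNReal.toReal_mono (c.P_ne_top _ _) hM
  have hK' : c.mass (c.branch b) ≤ K.toReal * c.wt b := by
    have := ENNReal.toReal_mono c.iSup_piSet_div_ne_top hK
    rw [ENNReal.toReal_div, toReal_piSet] at this
    exact (div_le_iff₀ (c.wt_pos b)).1 this
  have hw := c.wt_pos b
  have hm := c.mass_nonneg (c.branch b)
  rw [ENNReal.toReal_div, ENNReal.toReal_pow, cond, div_mul_eq_mul_div, div_mul_eq_mul_div]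
  rw [div_le_div_iff₀ (mul_pos hw (hM0.trans_le hM')) hM0]
  calc c.mass (c.branch b) * c.mass (c.branch b) * M.toReal
      ≤ (K.toReal * c.wt b) * (K.toReal * c.wt b) * c.prob b (c.par b) := by gcongr
    _ = K.toReal ^ 2 * c.wt b * (c.wt b * c.prob b (c.par b)) := by ring

end TreeChain

/-- **Corollary (second moment bound)**: on a finite tree, with
`K' = sup_{b≠0} π(B_b)/π(b)` and `K'_μ = inf_{b≠0} μ_b`, for `0 ≤ j < n ≤ d(a)`,
`E[(T^{a_n}_{a_j})²] ≤ E[T^{a_n}_{a_j}]·(2·(K'²/K'_μ + E[T^0_{a_j}]) − 1)`. -/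
theorem ET2_iterate_down_le {I : Type*} [MeasurableSpace I] [Finite I]
    (c : TreeChain I) (a : I) (ha : a ≠ c.root)
    (j n : ℕ) (hjn : j < n) (hn : n ≤ c.depth a) :
    c.ET2 (c.par^[n] a) (c.par^[j] a)
      ≤ c.ET (c.par^[n] a) (c.par^[j] a) *
          (2 * ((⨆ b ∈ {b : I | b ≠ c.root}, c.piSet (c.branch b) / c.invm b) ^ 2 /
                  (⨅ b ∈ {b : I | b ≠ c.root}, c.mu b) +
                c.ET c.root (c.par^[j] a)) - 1) := by
  have := Fintype.ofFinite I
  have := c.measurableSingletonClass ha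
  obtain ⟨i, rfl⟩ := Nat.exists_eq_add_of_le' hjn.le
  rw [Function.iterate_add_apply]
  refine (c.ET2_iterate_par_le_ofReal _ (fun b hb => c.mass_div_cond_mul_mass_le hb) i).trans ?_
  rw [c.ET_eq_ofReal_mean, c.ET_eq_ofReal_mean, ENNReal.ofReal_mul (c.mean_nonneg _ _),
    ENNReal.ofReal_sub _ zero_le_one, ENNReal.ofReal_mul zero_le_two,
    ENNReal.ofReal_add ENNReal.toReal_nonneg (c.mean_nonneg _ _), ENNReal.ofReal_toReal
      (ENNReal.div_ne_top (ENNReal.pow_ne_top c.iSup_piSet_div_ne_top) c.iInf_mu_ne_zero),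
    ENNReal.ofReal_one, ENNReal.ofReal_ofNat]
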